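/- Let a be a unit of S. (i) The classes of skew (σ,a)-constacyclic codes and skew σ-cyclic codes (i.e. skew (σ,1)-constacyclic codes) of length m over S are equivalent if and only if a ∈ N_m^σ(S^×); moreover equivalence and Chen equivalence coincide here. (ii) The classes of skew (σ,a)-constacyclic codes and skew σ-negacyclic codes (i.e. skew (σ,−1)-constacyclic codes) of length m are equivalent if and only if −a ∈ N_m^σ(S^×); again equivalence and Chen equivalence coincide. -/

import Mathlib

/-- `Nsig σ i β = ∏_{j=0}^{i-1} σ^j(β)`. -/
def Nsig {S : Type*} [CommRing S] (σ : S ≃+* S) (i : ℕ) (β : S) : S :=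
  ∏ j ∈ Finset.range i, (σ ^ j) β

/-- The coefficient vector of the monomial `c·t^k` in `S^m`. -/
def stdVec {S : Type*} [Ring S] (m k : ℕ) (c : S) : Fin m → S :=
  fun j => if (j : ℕ) = k then c else 0

/-- Left multiplication by `t`, followed by reduction modulo `f = t^m − ∑ a_i t^i`,
on coefficient vectors representing elements of the Petit algebra `S[t;σ]/S[t;σ]f`. -/
def tmul {S : Type*} [Ring S] (σ : S ≃+* S) {m : ℕ} (a : Fin m → S)
    (c : Fin m → S) : Fin m → S :=
  fun j =>
    (if _ : (j : ℕ) = 0 then 0 else σ (c ⟨(j : ℕ) - 1, by have := j.isLt; omega⟩)) +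
      σ (c ⟨m - 1, by have := j.isLt; omega⟩) * a j

/-- The multiplication of the Petit algebra `S[t;σ]/S[t;σ]f`, `f = t^m − ∑ a_i t^i`:
`g ∘ h` is the remainder of the skew-polynomial product `g·h` under right division by `f`. -/
def petitMul {S : Type*} [Ring S] (σ : S ≃+* S) {m : ℕ} (a : Fin m → S)
    (g h : Fin m → S) : Fin m → S :=
  fun j => ∑ i : Fin m, g i * (tmul σ a)^[(i : ℕ)] h j

/-- The map `G_{τ,α} : ∑ d_i t^i ↦ ∑ τ(d_i) N_i^σ(α) t^i` on coefficient vectors. -/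
def Gmap {S : Type*} [CommRing S] (σ τ : S ≃+* S) (α : S) {m : ℕ}
    (d : Fin m → S) : Fin m → S :=
  fun i => τ (d i) * Nsig σ (i : ℕ) α

/-- `G` is an isomorphism from the Petit algebra `S[t;σ]/S[t;σ](t^m − ∑ a_i t^i)` to the
Petit algebra `S[t;σ]/S[t;σ](t^m − ∑ b_i t^i)`: a bijective, additive, unital and
multiplicative map on coefficient vectors. -/
def IsPetitIso {S : Type*} [Ring S] (σ : S ≃+* S) {m : ℕ} (a b : Fin m → S)
    (G : (Fin m → S) → (Fin m → S)) : Prop :=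
  Function.Bijective G ∧ (∀ x y, G (x + y) = G x + G y) ∧
    G (stdVec m 0 1) = stdVec m 0 1 ∧
    (∀ x y, G (petitMul σ a x y) = petitMul σ b (G x) (G y))

theorem Nsig_succ {S : Type*} [CommRing S] (σ : S ≃+* S) (i : ℕ) (α : S) :
    Nsig σ (i + 1) α = α * σ (Nsig σ i α) := by
  simp only [Nsig, Finset.prod_range_succ', map_prod, pow_succ', RingAut.mul_apply, pow_zero,
    RingAut.one_apply, mul_comm]

theorem IsUnit.nsig {S : Type*} [CommRing S] (σ : S ≃+* S) {α : S} (hα : IsUnit α) (i : ℕ) :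
    IsUnit (Nsig σ i α) := by
  induction i with
  | zero => simp [Nsig]
  | succ i ih => rw [Nsig_succ]; exact hα.mul (ih.map σ)

theorem map_Nsig {S : Type*} [CommRing S] {σ τ : S ≃+* S} (h : ∀ x, σ (τ x) = τ (σ x))
    (i : ℕ) (α : S) : τ (Nsig σ i α) = Nsig σ i (τ α) := by
  induction i with
  | zero => simp [Nsig]
  | succ i ih => rw [Nsig_succ, Nsig_succ, map_mul, ← h, ih]

theorem tmul_smul {S : Type*} [CommRing S] (σ : S ≃+* S) {m : ℕ} (a : Fin m → S) (c : S)
    (h : Fin m → S) : tmul σ a (c • h) = σ c • tmul σ a h := by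
  funext j
  simp only [tmul, Pi.smul_apply, smul_eq_mul, map_mul]
  split_ifs <;> ring

theorem petitMul_stdVec_one {S : Type*} [CommRing S] (σ : S ≃+* S) {m : ℕ} (hm : 1 < m)
    (a : Fin m → S) (c : S) (h : Fin m → S) :
    petitMul σ a (stdVec m 1 c) h = c • tmul σ a h := by
  funext j
  rw [petitMul, Finset.sum_eq_single (⟨1, hm⟩ : Fin m)]
  · simp [stdVec]
  · intro i _ hi
    have : (i : ℕ) ≠ 1 := fun h => hi (Fin.ext h)
    simp [stdVec, this]
  · simp

theorem Gmap_stdVec {S : Type*} [CommRing S] (σ τ : S ≃+* S) (α : S) (m k : ℕ) (c : S) :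
    Gmap σ τ α (stdVec m k c) = stdVec m k (τ c * Nsig σ k α) := by
  funext j
  by_cases h : (j : ℕ) = k <;> simp [Gmap, stdVec, h]

theorem Gmap_bijective {S : Type*} [CommRing S] (σ τ : S ≃+* S) {α : S} (hα : IsUnit α)
    (m : ℕ) : Function.Bijective (Gmap σ τ α (m := m)) := by
  refine ⟨fun x y hxy => funext fun i => ?_, fun y => ?_⟩
  · exact τ.injective ((hα.nsig σ i).mul_right_cancel (congrFun hxy i))
  · choose u hu using fun i : ℕ => hα.nsig σ i
    refine ⟨fun i => τ.symm (y i * ((u i)⁻¹ : Sˣ)), funext fun i => ?_⟩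
    simp [Gmap, ← hu, mul_assoc]

theorem Gmap_tmul {S : Type*} [CommRing S] {σ τ : S ≃+* S} (hστ : ∀ x, σ (τ x) = τ (σ x))
    {α a b : S} {m : ℕ} (hab : τ a = Nsig σ m α * b) (h : Fin m → S) :
    Gmap σ τ α (tmul σ (stdVec m 0 a) h) = α • tmul σ (stdVec m 0 b) (Gmap σ τ α h) := by
  obtain _ | m := m
  · exact Subsingleton.elim _ _
  funext ⟨j, hj⟩
  obtain _ | j := j
  · simp only [Nsig_succ] at hab
    simp [Gmap, tmul, stdVec, hab, hστ, Nsig]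
    ring
  · simp [Gmap, tmul, stdVec, hστ, Nsig_succ]
    ring

theorem Gmap_tmul_iterate {S : Type*} [CommRing S] {σ τ : S ≃+* S}
    (hστ : ∀ x, σ (τ x) = τ (σ x)) {α a b : S} {m : ℕ} (hab : τ a = Nsig σ m α * b)
    (h : Fin m → S) (i : ℕ) :
    Gmap σ τ α ((tmul σ (stdVec m 0 a))^[i] h) =
      Nsig σ i α • (tmul σ (stdVec m 0 b))^[i] (Gmap σ τ α h) := by
  induction i with
  | zero => simp [Nsig]
  | succ i ih =>
    rw [Function.iterate_succ_apply', Function.iterate_succ_apply', Gmap_tmul hστ hab, ih,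
      tmul_smul, smul_smul, ← Nsig_succ]

theorem isPetitIso_Gmap_iff {S : Type*} [CommRing S] {σ τ : S ≃+* S}
    (hστ : ∀ x, σ (τ x) = τ (σ x)) {α : S} (hα : IsUnit α) (a b : S) {m : ℕ} (hm : 1 < m) :
    IsPetitIso σ (stdVec m 0 a) (stdVec m 0 b) (Gmap σ τ α) ↔ τ a = Nsig σ m α * b := by
  constructor
  · rintro ⟨-, -, -, hmul⟩
    obtain ⟨k, rfl⟩ : ∃ k, m = k + 2 := ⟨m - 2, by omega⟩
    have h := congrFun (hmul (stdVec (k + 2) 1 1) (stdVec (k + 2) (k + 1) 1)) 0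
    rw [petitMul_stdVec_one σ hm, Gmap_stdVec, Gmap_stdVec, petitMul_stdVec_one σ hm] at h
    rw [Nsig_succ σ (k + 1)]
    simpa [Gmap, tmul, stdVec, Nsig, mul_assoc] using h
  · intro hab
    refine ⟨Gmap_bijective σ τ hα m, fun x y => funext fun i => ?_, ?_, fun x y => ?_⟩
    · simp [Gmap, add_mul]
    · simp [Gmap_stdVec, Nsig]
    · funext j
      have key (i : ℕ) := congrFun (Gmap_tmul_iterate hστ hab y i) j
      simp only [Gmap, Pi.smul_apply, smul_eq_mul] at key
      simp only [Gmap, petitMul, map_sum, map_mul, Finset.sum_mul, mul_assoc, key]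

theorem exists_isPetitIso_Gmap_iff {S : Type*} [CommRing S] (σ : S ≃+* S) {m : ℕ} (hm : 1 < m)
    {a b : S} (hb : b * b = 1) (hτb : ∀ τ : S ≃+* S, τ b = b) :
    (∃ τ : S ≃+* S, σ * τ = τ * σ ∧ ∃ α : S, IsUnit α ∧
        IsPetitIso σ (stdVec m 0 a) (stdVec m 0 b) (Gmap σ τ α)) ↔
      ∃ α : S, IsUnit α ∧ Nsig σ m α = a * b := by
  constructor
  · rintro ⟨τ, hστ, α, hα, h⟩
    have hc (x : S) : σ (τ x) = τ (σ x) := DFunLike.congr_fun hστ x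
    rw [isPetitIso_Gmap_iff hc hα a b hm] at h
    have hc' (x : S) : σ (τ.symm x) = τ.symm (σ x) := by
      rw [RingEquiv.eq_symm_apply, ← hc, RingEquiv.apply_symm_apply]
    refine ⟨τ.symm α, hα.map τ.symm, ?_⟩
    rw [← map_Nsig hc', RingEquiv.symm_apply_eq, map_mul, hτb, h, mul_assoc, hb, mul_one]
  · rintro ⟨α, hα, h⟩
    refine ⟨RingEquiv.refl S, rfl, α, hα, ?_⟩
    rw [isPetitIso_Gmap_iff (σ := σ) (τ := .refl S) (fun _ => rfl) hα a b hm, h, mul_assoc, hb,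
      mul_one]
    rfl

theorem exists_isPetitIso_Gmap_refl_iff {S : Type*} [CommRing S] (σ : S ≃+* S) {m : ℕ}
    (hm : 1 < m) {a b : S} (hb : b * b = 1) :
    (∃ α : S, IsUnit α ∧
        IsPetitIso σ (stdVec m 0 a) (stdVec m 0 b) (Gmap σ (RingEquiv.refl S) α)) ↔
      ∃ α : S, IsUnit α ∧ Nsig σ m α = a * b := by
  refine exists_congr fun α => and_congr_right fun hα => ?_
  rw [isPetitIso_Gmap_iff (σ := σ) (τ := .refl S) (fun _ => rfl) hα a b hm, RingEquiv.refl_apply]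
  constructor
  · rintro rfl
    rw [mul_assoc, hb, mul_one]
  · intro h
    rw [h, mul_assoc, hb, mul_one]

/-- **Corollary.**  Let `a ∈ S^×`.  (i) The classes of skew `(σ,a)`-constacyclic codes and
skew `σ`-cyclic codes of length `m` are equivalent iff `a ∈ N_m^σ(S^×)`; equivalence and
Chen equivalence coincide.  (ii) The classes of skew `(σ,a)`-constacyclic codes and skew
`σ`-negacyclic codes of length `m` are equivalent iff `−a ∈ N_m^σ(S^×)`; again
equivalence and Chen equivalence coincide. -/
theorem stmt12 {S : Type*} [CommRing S] (σ : S ≃+* S) (n : ℕ) (hn : 0 < n)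
    (hord : orderOf σ = n) (m : ℕ) (hm : 1 < m) (a : S) (ha : IsUnit a) :
    ((∃ τ : S ≃+* S, σ * τ = τ * σ ∧ ∃ α : S, IsUnit α ∧
        IsPetitIso σ (stdVec m 0 a) (stdVec m 0 1) (Gmap σ τ α)) ↔
      ∃ α : S, IsUnit α ∧ Nsig σ m α = a) ∧
    ((∃ τ : S ≃+* S, σ * τ = τ * σ ∧ ∃ α : S, IsUnit α ∧
        IsPetitIso σ (stdVec m 0 a) (stdVec m 0 1) (Gmap σ τ α)) ↔
      ∃ α : S, IsUnit α ∧
        IsPetitIso σ (stdVec m 0 a) (stdVec m 0 1) (Gmap σ (RingEquiv.refl S) α)) ∧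
    ((∃ τ : S ≃+* S, σ * τ = τ * σ ∧ ∃ α : S, IsUnit α ∧
        IsPetitIso σ (stdVec m 0 a) (stdVec m 0 (-1)) (Gmap σ τ α)) ↔
      ∃ α : S, IsUnit α ∧ Nsig σ m α = -a) ∧
    ((∃ τ : S ≃+* S, σ * τ = τ * σ ∧ ∃ α : S, IsUnit α ∧
        IsPetitIso σ (stdVec m 0 a) (stdVec m 0 (-1)) (Gmap σ τ α)) ↔
      ∃ α : S, IsUnit α ∧
        IsPetitIso σ (stdVec m 0 a) (stdVec m 0 (-1)) (Gmap σ (RingEquiv.refl S) α)) := by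
  have h1 := exists_isPetitIso_Gmap_iff σ hm (a := a) (mul_one (1 : S)) fun τ => map_one τ
  have h2 := exists_isPetitIso_Gmap_refl_iff σ hm (a := a) (mul_one (1 : S))
  have hneg : (-1 : S) * -1 = 1 := by ring
  have h3 := exists_isPetitIso_Gmap_iff σ hm (a := a) hneg fun τ => by simp
  have h4 := exists_isPetitIso_Gmap_refl_iff σ hm (a := a) hneg
  rw [mul_one] at h1 h2
  rw [mul_neg_one] at h3 h4
  exact ⟨h1, h1.trans h2.symm, h3, h3.trans h4.symm⟩
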